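/- Let G be a strongly balanced connected graph with v(G) ≥ 2 vertices and e(G) edges. If n^{−(v(G)−1)/e(G)} ≪ p_n, i.e. n·p_n^{e(G)/(v(G)−1)} → ∞, then there exists n₀ such that for all n ≥ n₀ and all j ≥ 2, |κ_j(N_G)| ≤ j^{j−1} (j!)^{v(G)} (v(G)!)^{j−1} a(G)^{−j} n^{1+(v(G)−1)j} p_n^{j·e(G)}. -/

import Mathlib

open MeasureTheory Finset ProbabilityTheory

/-- The joint cumulant, via the moment–cumulant formula. -/
noncomputable def jointCumulant {Ω : Type*} [MeasurableSpace Ω] (P : Measure Ω)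
    {j : ℕ} (Z : Fin j → Ω → ℝ) : ℝ :=
  ∑ σ : Finpartition (Finset.univ : Finset (Fin j)),
    (-1 : ℝ) ^ (σ.parts.card - 1) * ((σ.parts.card - 1).factorial : ℝ) *
      ∏ b ∈ σ.parts, ∫ ω, ∏ i ∈ b, Z i ω ∂P

/-- The `j`-th cumulant `κ_j(W)` of a random variable `W`. -/
noncomputable def cum {Ω : Type*} [MeasurableSpace Ω] (P : Measure Ω)
    (j : ℕ) (W : Ω → ℝ) : ℝ :=
  jointCumulant P (fun _ : Fin j => W)

/-- The size `a(G)` of the automorphism group of `G`. -/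
noncomputable def autCard {k : ℕ} (G : SimpleGraph (Fin k)) : ℕ := Nat.card (G ≃g G)

/-- The injective subgraph count `N_G` in the binomial random-connection model:
vertices `X_1,…,X_n`, and `X_i ∼ X_j` iff `Y_{i,j} ≤ p_n H(X_i,X_j)` where the
`Y_{i,j}` are i.i.d. uniform on `[0,1]`. -/
noncomputable def NG {d k n : ℕ} {Ω : Type*} (G : SimpleGraph (Fin k)) [DecidableRel G.Adj]
    (H : (Fin d → ℝ) → (Fin d → ℝ) → ℝ) (pn : ℝ) (aG : ℕ)
    (X : Fin n → Ω → (Fin d → ℝ)) (Y : Fin n → Fin n → Ω → ℝ) (ω : Ω) : ℝ :=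
  (aG : ℝ)⁻¹ * ∑ β ∈ (Finset.univ : Finset (Fin k → Fin n)).filter Function.Injective,
    ∏ q ∈ (Finset.univ : Finset (Fin k × Fin k)).filter (fun q => q.1 < q.2 ∧ G.Adj q.1 q.2),
      if Y (β q.1) (β q.2) ω ≤ pn * H (X (β q.1) ω) (X (β q.2) ω) then (1 : ℝ) else 0

/-- The projection `f_{(ℓ)}` of the subgraph-count functional:
`f_{(ℓ)}(x) = (p^{e(G)}/a(G)) ∫ ∏_{(ı,ȷ)∈E_G} H(x_ı,x_ȷ) dμ^{⊗(k−1)}` with `x_ℓ = x`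
(the unused `ℓ`-th coordinate is also integrated out, which is harmless since `μ` is a
probability measure). -/
noncomputable def fSub {d k : ℕ} (G : SimpleGraph (Fin k)) [DecidableRel G.Adj]
    (H : (Fin d → ℝ) → (Fin d → ℝ) → ℝ) (μ : Measure (Fin d → ℝ)) (pn : ℝ) (aG : ℕ)
    (ℓ : Fin k) (x : Fin d → ℝ) : ℝ :=
  (pn ^ G.edgeFinset.card / (aG : ℝ)) *
    ∫ z : Fin k → (Fin d → ℝ),
      ∏ q ∈ (Finset.univ : Finset (Fin k × Fin k)).filter
          (fun q => q.1 < q.2 ∧ G.Adj q.1 q.2),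
        H (Function.update z ℓ x q.1) (Function.update z ℓ x q.2)
      ∂(Measure.pi fun _ => μ)

/-- A graph `G` is strongly balanced if `e(H)/(v(H)−1) ≤ e(G)/(v(G)−1)` for every
subgraph `H` of `G` with at least two vertices. -/
def StronglyBalanced {k : ℕ} (G : SimpleGraph (Fin k)) [DecidableRel G.Adj] : Prop :=
  ∀ Hs : G.Subgraph, 2 ≤ Hs.verts.ncard →
    Hs.edgeSet.ncard * (k - 1) ≤ G.edgeFinset.card * (Hs.verts.ncard - 1)

theorem sum_prod_fiber_eq_sum_finpartition {α : Type*} [Fintype α] [DecidableEq α]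
    (m : Finset α → ℝ) (hm : m ∅ = 1) (N : ℕ) :
    ∑ φ : α → Fin N, ∏ l, m (univ.filter (φ · = l)) =
      ∑ σ : Finpartition (univ : Finset α),
        (N.descFactorial σ.parts.card : ℝ) * ∏ b ∈ σ.parts, m b := by
  have h1 : ∀ σ : Finpartition (univ : Finset α),
      (N.descFactorial σ.parts.card : ℝ) * ∏ b ∈ σ.parts, m b =
        ∑ _e : σ.parts ↪ Fin N, ∏ b ∈ σ.parts, m b := by
    intro σ
    rw [sum_const, card_univ, Fintype.card_embedding_eq, Fintype.card_fin, Fintype.card_coe,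
      nsmul_eq_mul]
  simp_rw [h1]
  rw [← Fintype.sum_sigma' (fun (σ : Finpartition (univ : Finset α)) (_e : σ.parts ↪ Fin N) =>
    ∏ b ∈ σ.parts, m b)]
  symm
  have hfib : ∀ (σ : Finpartition (univ : Finset α)) (e : σ.parts ↪ Fin N) (b : σ.parts),
      univ.filter (fun a => e ⟨σ.part a, σ.part_mem.2 (mem_univ a)⟩ = e b) = b.1 := by
    intro σ e b
    ext a
    simp only [mem_filter, mem_univ, true_and, EmbeddingLike.apply_eq_iff_eq]
    rw [Subtype.ext_iff]
    exact σ.part_eq_iff_mem b.2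
  refine Fintype.sum_bijective
    (fun (x : Σ σ : Finpartition (univ : Finset α), σ.parts ↪ Fin N) (a : α) =>
      x.2 ⟨x.1.part a, x.1.part_mem.2 (mem_univ a)⟩) ⟨?_, ?_⟩ _ _ ?_
  · rintro ⟨σ, e⟩ ⟨τ, f⟩ h
    have hpart : ∀ a, σ.part a = τ.part a := by
      intro a
      refine (hfib σ e ⟨σ.part a, σ.part_mem.2 (mem_univ a)⟩).symm.trans
        (Eq.trans ?_ (hfib τ f ⟨τ.part a, τ.part_mem.2 (mem_univ a)⟩))
      ext c
      have h1 := congrFun h a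
      have h2 := congrFun h c
      simp only at h1 h2
      simp [h1, h2]
    have hle : ∀ (σ τ : Finpartition (univ : Finset α)), (∀ a, σ.part a = τ.part a) →
        σ.parts ⊆ τ.parts := by
      intro σ τ h b hb
      obtain ⟨a, ha⟩ := σ.nonempty_of_mem_parts hb
      rw [← (σ.part_eq_iff_mem hb).2 ha, h a]
      exact τ.part_mem.2 (mem_univ a)
    have hst : σ = τ := by
      ext1
      exact Subset.antisymm (hle σ τ hpart) (hle τ σ fun a => (hpart a).symm)
    subst hst
    congr 1
    ext ⟨b, hb⟩ : 1
    obtain ⟨a, ha⟩ := σ.nonempty_of_mem_parts hb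
    have h1 := congrFun h a
    have hba := (σ.part_eq_iff_mem hb).2 ha
    simp only [hba] at h1
    exact h1
  · intro φ
    classical
    let σ : Finpartition (univ : Finset α) := Finpartition.ofSetoid (Setoid.ker φ)
    have hσ : ∀ a c, a ∈ σ.part c ↔ φ c = φ a := fun a c =>
      Finpartition.mem_part_ofSetoid_iff_rel
    have hne : ∀ b : σ.parts, b.1.Nonempty := fun b => σ.nonempty_of_mem_parts b.2
    have hval : ∀ (b : σ.parts) a, a ∈ b.1 → φ (hne b).choose = φ a := by
      intro b a ha
      rw [← hσ, (σ.part_eq_iff_mem b.2).2 (hne b).choose_spec]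
      exact ha
    refine ⟨⟨σ, ⟨fun b => φ (hne b).choose, ?_⟩⟩, ?_⟩
    · intro b c hbc
      have h1 := (hσ (hne c).choose (hne b).choose).2 hbc
      rw [(σ.part_eq_iff_mem b.2).2 (hne b).choose_spec] at h1
      have := (σ.part_eq_iff_mem b.2).2 h1
      rw [(σ.part_eq_iff_mem c.2).2 (hne c).choose_spec] at this
      exact Subtype.ext this.symm
    · funext a
      exact hval ⟨σ.part a, _⟩ a (σ.mem_part (mem_univ a))
  · rintro ⟨σ, e⟩
    simp only
    rw [← prod_subset (subset_univ (univ.map e)), prod_map, ← prod_coe_sort]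
    · exact prod_congr rfl fun b _ => by rw [hfib σ e b]
    · intro l _ hl
      rw [← hm]
      congr 1
      refine filter_eq_empty_iff.2 fun a _ hc => hl ?_
      rw [← hc]
      exact mem_map_of_mem _ (mem_univ _)

open Polynomial in
/-- The polynomial whose value at `N` counts, with weight `m`, the maps into `Fin N`. -/
noncomputable def partitionPoly {α : Type*} [Fintype α] [DecidableEq α]
    (m : Finset α → ℝ) : ℝ[X] :=
  ∑ σ : Finpartition (univ : Finset α),
    C (∏ b ∈ σ.parts, m b) * descPochhammer ℝ σ.parts.card

theorem partitionPoly_eval {α : Type*} [Fintype α] [DecidableEq α]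
    (m : Finset α → ℝ) (hm : m ∅ = 1) (N : ℕ) :
    (partitionPoly m).eval (N : ℝ) = ∑ φ : α → Fin N, ∏ l, m (univ.filter (φ · = l)) := by
  rw [sum_prod_fiber_eq_sum_finpartition m hm N, partitionPoly, Polynomial.eval_finsetSum]
  refine sum_congr rfl fun σ _ => ?_
  rw [Polynomial.eval_mul, Polynomial.eval_C, descPochhammer_eval_eq_descFactorial, mul_comm]

theorem partitionPoly_coeff_zero {α : Type*} [Fintype α] [DecidableEq α] [Nonempty α]
    (m : Finset α → ℝ) (hm : m ∅ = 1) : (partitionPoly m).coeff 0 = 0 := by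
  rw [Polynomial.coeff_zero_eq_eval_zero, ← Nat.cast_zero, partitionPoly_eval m hm]
  rw [Nat.cast_zero]
  exact sum_eq_zero fun (φ : α → Fin 0) _ => (φ (Classical.arbitrary α)).elim0

theorem descPochhammer_eval_neg_one (n : ℕ) :
    (descPochhammer ℝ n).eval (-1) = (-1) ^ n * (n.factorial : ℝ) := by
  induction n with
  | zero => simp
  | succ n ih =>
    rw [descPochhammer_succ_right, Polynomial.eval_mul, ih, Nat.factorial_succ]
    simp
    ring

theorem finpartition_card_parts_pos {α : Type*} [Fintype α] [DecidableEq α] [Nonempty α]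
    (σ : Finpartition (univ : Finset α)) : 0 < σ.parts.card :=
  card_pos.2 (σ.parts_nonempty univ_nonempty.ne_empty)

theorem partitionPoly_coeff_one {α : Type*} [Fintype α] [DecidableEq α] [Nonempty α]
    (m : Finset α → ℝ) : (partitionPoly m).coeff 1 =
      ∑ σ : Finpartition (univ : Finset α),
        (-1 : ℝ) ^ (σ.parts.card - 1) * ((σ.parts.card - 1).factorial : ℝ) *
          ∏ b ∈ σ.parts, m b := by
  rw [partitionPoly, Polynomial.finsetSum_coeff]
  refine sum_congr rfl fun σ _ => ?_
  obtain ⟨r, hr⟩ := Nat.exists_eq_succ_of_ne_zero (finpartition_card_parts_pos σ).ne'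
  rw [hr, Polynomial.coeff_C_mul, descPochhammer_succ_left, Polynomial.coeff_X_mul,
    Polynomial.coeff_zero_eq_eval_zero, Polynomial.eval_comp]
  simp [descPochhammer_eval_neg_one]
  ring

/-- The moment-cumulant sum vanishes when the moments factorize along a proper subset. -/
theorem sum_finpartition_eq_zero_of_factorization {α : Type*} [Fintype α] [DecidableEq α]
    (m : Finset α → ℝ) (hm : m ∅ = 1) (A : Finset α) (hA : A.Nonempty) (hA' : Aᶜ.Nonempty)
    (hfac : ∀ b, m b = m (b.filter (· ∈ A)) * m (b.filter (· ∉ A))) :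
    ∑ σ : Finpartition (univ : Finset α),
        (-1 : ℝ) ^ (σ.parts.card - 1) * ((σ.parts.card - 1).factorial : ℝ) *
          ∏ b ∈ σ.parts, m b = 0 := by
  have : Nonempty α := ⟨hA.choose⟩
  have : Nonempty {a // a ∈ A} := ⟨⟨_, hA.choose_spec⟩⟩
  have : Nonempty {a // a ∉ A} := ⟨⟨_, mem_compl.1 hA'.choose_spec⟩⟩
  rw [← partitionPoly_coeff_one m]
  let m₁ : Finset {a // a ∈ A} → ℝ := fun b => m (b.map (Function.Embedding.subtype _))
  let m₂ : Finset {a // a ∉ A} → ℝ := fun b => m (b.map (Function.Embedding.subtype _))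
  have hm₁ : m₁ ∅ = 1 := by simp [m₁, hm]
  have hm₂ : m₂ ∅ = 1 := by simp [m₂, hm]
  have key : partitionPoly m = partitionPoly m₁ * partitionPoly m₂ := by
    refine Polynomial.eq_of_infinite_eval_eq _ _
      ((Set.infinite_range_of_injective (Nat.cast_injective (R := ℝ))).mono ?_)
    rintro _ ⟨N, rfl⟩
    simp only [Set.mem_ofPred_eq]
    rw [Polynomial.eval_mul, partitionPoly_eval m hm, partitionPoly_eval m₁ hm₁,
      partitionPoly_eval m₂ hm₂, sum_mul_sum, ← Fintype.sum_prod_type']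
    refine Fintype.sum_equiv (Equiv.piEquivPiSubtypeProd (· ∈ A) (fun _ => Fin N)) _ _ ?_
    intro φ
    rw [← prod_mul_distrib]
    refine prod_congr rfl fun l _ => ?_
    rw [hfac]
    congr 2
    · ext a
      simp [and_comm]
    · ext a
      simp [and_comm]
  rw [key, Polynomial.mul_coeff_one, partitionPoly_coeff_zero m₁ hm₁,
    partitionPoly_coeff_zero m₂ hm₂]
  ring

theorem sum_finpartition_factorial_le {j : ℕ} (hj : 0 < j) :
    ∑ σ : Finpartition (univ : Finset (Fin j)), ((σ.parts.card - 1).factorial : ℝ) ≤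
      (j : ℝ) ^ (j - 1) := by
  have h := sum_prod_fiber_eq_sum_finpartition (α := Fin j) (fun _ => (1 : ℝ)) rfl j
  simp only [prod_const_one, sum_const, card_univ, Fintype.card_fun, Fintype.card_fin,
    nsmul_eq_mul, mul_one] at h
  have : Nonempty (Fin j) := ⟨⟨0, hj⟩⟩
  have hj' : (0 : ℝ) < j := by exact_mod_cast hj
  refine le_of_mul_le_mul_left ?_ hj'
  rw [mul_pow_sub_one hj.ne', ← Nat.cast_pow, h, mul_sum]
  refine sum_le_sum fun σ _ => ?_
  have hle : σ.parts.card ≤ j := by simpa using σ.card_parts_le_card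
  obtain ⟨r, hr⟩ := Nat.exists_eq_succ_of_ne_zero (finpartition_card_parts_pos σ).ne'
  obtain ⟨i, rfl⟩ := Nat.exists_eq_succ_of_ne_zero hj.ne'
  rw [hr] at hle ⊢
  rw [← Nat.cast_mul, Nat.cast_le, Nat.succ_eq_add_one, Nat.succ_eq_add_one,
    Nat.succ_descFactorial_succ]
  refine Nat.mul_le_mul_left _ ?_
  rw [Nat.add_sub_cancel, ← Nat.descFactorial_self]
  exact Nat.descFactorial_le _ (by omega)

/-- Every entry of an array can be sent to the last earlier row in which its value occurs, or to
its own row if there is none. -/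
theorem exists_lastOccurrence {j k n : ℕ} (B : Fin j → Fin k → Fin n) :
    ∃ f : Fin j → Fin k → Fin j, ∀ r c, f r c ≤ r ∧
      (f r c < r → ∃ c', B (f r c) c' = B r c) ∧
      ∀ r', r' < r → (f r c = r ∨ f r c < r') → ∀ c', B r' c' ≠ B r c := by
  have h : ∀ r c, ∃ s : Fin j, s ≤ r ∧ (s < r → ∃ c', B s c' = B r c) ∧
      ∀ r', r' < r → (s = r ∨ s < r') → ∀ c', B r' c' ≠ B r c := by
    intro r c
    by_cases hS : (univ.filter fun r' => r' < r ∧ ∃ c', B r' c' = B r c).Nonempty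
    · have hmem := max'_mem _ hS
      have hmax := le_max' (univ.filter fun r' => r' < r ∧ ∃ c', B r' c' = B r c)
      simp only [mem_filter, mem_univ, true_and] at hmem hmax
      refine ⟨_, hmem.1.le, fun _ => hmem.2, fun r' hr' hs c' hc' => ?_⟩
      rcases hs with hs | hs
      · exact hmem.1.ne hs
      · exact absurd (hmax r' ⟨hr', c', hc'⟩) (not_le.2 hs)
    · refine ⟨r, le_rfl, fun h => absurd h (lt_irrefl r), fun r' hr' _ c' hc' => hS ⟨r', ?_⟩⟩
      simpa using ⟨hr', c', hc'⟩
  choose f hf using h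
  exact ⟨f, hf⟩

theorem card_le_fin_pow_mul_prod_embedding {j k n : ℕ} (g : Fin j → Fin k → Fin j)
    (S : Finset (Fin j → Fin k → Fin n)) (hS : ∀ B ∈ S, ∀ r, Function.Injective (B r))
    (hg : ∀ B ∈ S, ∀ r c, g r c ≤ r ∧
      (g r c < r → ∃ c', B (g r c) c' = B r c) ∧
      ∀ r', r' < r → (g r c = r ∨ g r c < r') → ∀ c', B r' c' ≠ B r c) :
    S.card ≤ n ^ (univ.filter fun q : Fin j × Fin k => g q.1 q.2 = q.1).card *
      k.factorial ^ (j - 1) := by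
  classical
  let New := {q : Fin j × Fin k // g q.1 q.2 = q.1}
  let Succ := fun r : Fin j => {q : Fin j × Fin k // g q.1 q.2 = r ∧ r < q.1}
  have hemb : ∀ B : S, ∀ r : Fin j, ∃ e : Succ r ↪ Fin k,
      ∀ q : Succ r, B.1 r (e q) = B.1 q.1.1 q.1.2 := by
    intro B r
    have h1 : ∀ q : Succ r, ∃ c, B.1 r c = B.1 q.1.1 q.1.2 := by
      rintro ⟨q, hq, hq'⟩
      obtain ⟨c, hc⟩ := (hg B.1 B.2 q.1 q.2).2.1 (hq ▸ hq')
      exact ⟨c, by rw [← hc, hq]⟩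
    choose e he using h1
    have hlt : ∀ q q' : Succ r, e q = e q' → ¬ q.1.1 < q'.1.1 := by
      intro q q' hqq hlt
      refine (hg B.1 B.2 q'.1.1 q'.1.2).2.2 q.1.1 hlt (Or.inr ?_) q.1.2 ?_
      · rw [q'.2.1]
        exact q.2.2
      · rw [← he q, ← he q', hqq]
    refine ⟨⟨e, fun q q' hqq => ?_⟩, he⟩
    have hrow : q.1.1 = q'.1.1 :=
      le_antisymm (not_lt.1 (hlt q' q hqq.symm)) (not_lt.1 (hlt q q' hqq))
    refine Subtype.ext (Prod.ext hrow (hS B.1 B.2 q.1.1 ?_))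
    rw [← he q, hqq, he q', hrow]
  choose e he using hemb
  let code : S → (New → Fin n) × (∀ r, Succ r ↪ Fin k) :=
    fun B => (fun q => B.1 q.1.1 q.1.2, e B)
  have hinj : Function.Injective code := by
    intro B B' h
    have h1 : ∀ q : New, B.1 q.1.1 q.1.2 = B'.1 q.1.1 q.1.2 := congrFun (congrArg Prod.fst h)
    have h2 : ∀ r, e B r = e B' r := congrFun (congrArg Prod.snd h)
    have h3 : ∀ r, ∀ c, B.1 r c = B'.1 r c := by
      intro r
      induction r using WellFoundedLT.induction with
      | ind r ih =>
        intro c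
        rcases (hg B.1 B.2 r c).1.eq_or_lt with hr | hr
        · exact h1 ⟨(r, c), hr⟩
        · rw [← he B (g r c) ⟨(r, c), rfl, hr⟩, ← he B' (g r c) ⟨(r, c), rfl, hr⟩, h2]
          exact ih _ hr _
    exact Subtype.ext (funext fun r => funext (h3 r))
  have hcard := Fintype.card_le_of_injective code hinj
  rw [Fintype.card_coe, Fintype.card_prod, Fintype.card_fun, Fintype.card_fin,
    Fintype.card_subtype, Fintype.card_pi] at hcard
  refine hcard.trans (Nat.mul_le_mul_left _ ?_)
  rcases j with _ | j
  · simp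
  · rw [Fin.prod_univ_castSucc]
    have hlast : Fintype.card (Succ (Fin.last j) ↪ Fin k) ≤ 1 := by
      have : IsEmpty (Succ (Fin.last j)) :=
        ⟨fun q => absurd q.2.2 (not_lt.2 (Fin.le_last _))⟩
      rw [Fintype.card_embedding_eq, Fintype.card_eq_zero (α := Succ (Fin.last j)),
        Nat.descFactorial_zero]
    refine (Nat.mul_le_mul (prod_le_pow_card _ _ k.factorial fun r _ => ?_) hlast).trans ?_
    · rw [Fintype.card_embedding_eq, Fintype.card_fin]
      rcases le_or_gt (Fintype.card (Succ r.castSucc)) k with h | h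
      · exact Nat.le_of_dvd (Nat.factorial_pos k)
          ⟨(k - Fintype.card (Succ r.castSucc)).factorial, by
            rw [mul_comm, Nat.factorial_mul_descFactorial h]⟩
      · rw [Nat.descFactorial_of_lt h]
        exact Nat.zero_le _
    · simp

theorem sum_inv_pow_card_image_le {j k n : ℕ} (hn : 0 < n) :
    ∑ B ∈ (univ : Finset (Fin j → Fin k → Fin n)).filter (fun B => ∀ r, Function.Injective (B r)),
      ((n : ℝ) ^ (univ.image fun q : Fin j × Fin k => B q.1 q.2).card)⁻¹ ≤
        (j.factorial : ℝ) ^ k * (k.factorial : ℝ) ^ (j - 1) := by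
  classical
  choose f hf using fun B : Fin j → Fin k → Fin n => exists_lastOccurrence B
  have hn1 : (1 : ℝ) ≤ n := by exact_mod_cast hn
  have hn0 : (0 : ℝ) < n := by exact_mod_cast hn
  let T : Finset (Fin j → Fin k → Fin j) :=
    Fintype.piFinset fun r => Fintype.piFinset fun _ => Iic r
  have hT : (T.card : ℝ) = (j.factorial : ℝ) ^ k := by
    simp only [T, Fintype.card_piFinset, Fin.card_Iic, prod_const, card_univ, Fintype.card_fin]
    rw [prod_pow, Fin.prod_univ_eq_prod_range (fun i => i + 1) j,
      prod_range_add_one_eq_factorial]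
    push_cast
    rfl
  have hnew : ∀ B : Fin j → Fin k → Fin n, (∀ r, Function.Injective (B r)) →
      (univ.filter fun q : Fin j × Fin k => f B q.1 q.2 = q.1).card ≤
        (univ.image fun q : Fin j × Fin k => B q.1 q.2).card := by
    intro B hB
    rw [← card_image_of_injOn (f := fun q : Fin j × Fin k => B q.1 q.2)]
    · exact card_le_card (image_subset_image (filter_subset _ _))
    · have hlt : ∀ q q' : Fin j × Fin k, f B q'.1 q'.2 = q'.1 → B q.1 q.2 = B q'.1 q'.2 →
          ¬ q.1 < q'.1 := fun q q' hq' hqq hlt =>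
        (hf B q'.1 q'.2).2.2 q.1 hlt (Or.inl hq') q.2 hqq
      intro q hq q' hq' hqq
      simp only [coe_filter, mem_univ, true_and, Set.mem_ofPred_eq] at hq hq' hqq
      have hrow : q.1 = q'.1 :=
        le_antisymm (not_lt.1 (hlt q' q hq hqq.symm)) (not_lt.1 (hlt q q' hq' hqq))
      refine Prod.ext hrow (hB q.1 ?_)
      rw [hqq, hrow]
  rw [← hT, ← sum_fiberwise_of_maps_to (g := f) (t := T)]
  · rw [← nsmul_eq_mul]
    refine sum_le_card_nsmul _ _ _ fun g _ => ?_
    have hcard := card_le_fin_pow_mul_prod_embedding g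
      (((univ : Finset (Fin j → Fin k → Fin n)).filter
        (fun B => ∀ r, Function.Injective (B r))).filter fun B => f B = g)
      (fun B hB => (mem_filter.1 (mem_filter.1 hB).1).2)
      (fun B hB => (mem_filter.1 hB).2 ▸ hf B)
    have hpos : (0 : ℝ) < (n : ℝ) ^ (univ.filter fun q : Fin j × Fin k => g q.1 q.2 = q.1).card :=
      pow_pos hn0 _
    refine (sum_le_card_nsmul _ _
      ((n : ℝ) ^ (univ.filter fun q : Fin j × Fin k => g q.1 q.2 = q.1).card)⁻¹ ?_).trans ?_
    · intro B hB
      obtain ⟨hB1, rfl⟩ := mem_filter.1 hB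
      exact inv_anti₀ hpos (pow_le_pow_right₀ hn1 (hnew B (mem_filter.1 hB1).2))
    · rw [nsmul_eq_mul, ← div_eq_mul_inv, div_le_iff₀ hpos, mul_comm]
      exact_mod_cast hcard
  · intro B _
    simp only [T, Fintype.mem_piFinset, mem_Iic]
    exact fun r c => (hf B r c).1

/-- The vertices used by the copies `B i`, `i ∈ A`. -/
def copyVerts {j k n : ℕ} (B : Fin j → Fin k → Fin n) (A : Finset (Fin j)) : Finset (Fin n) :=
  A.biUnion fun i => univ.image (B i)

/-- The edges used by the copies `B i` of `G`, `i ∈ A`. -/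
def copyEdges {j k n : ℕ} (G : SimpleGraph (Fin k)) [DecidableRel G.Adj]
    (B : Fin j → Fin k → Fin n) (A : Finset (Fin j)) : Finset (Sym2 (Fin n)) :=
  A.biUnion fun i => G.edgeFinset.image (Sym2.map (B i))

theorem mem_copyVerts_of_mem_copyEdges {j k n : ℕ} (G : SimpleGraph (Fin k)) [DecidableRel G.Adj]
    (B : Fin j → Fin k → Fin n) (A : Finset (Fin j)) {s : Sym2 (Fin n)}
    (hs : s ∈ copyEdges G B A) {x : Fin n} (hx : x ∈ s) : x ∈ copyVerts B A := by
  simp only [copyEdges, mem_biUnion, mem_image] at hs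
  obtain ⟨i, hi, t, _, rfl⟩ := hs
  obtain ⟨a, _, rfl⟩ := Sym2.mem_map.1 hx
  exact mem_biUnion.2 ⟨i, hi, mem_image_of_mem _ (mem_univ a)⟩

/-- Strong balancedness bounds the overlap of a copy of `G` with an edge set. -/
theorem StronglyBalanced.overlap_le {k n : ℕ} {G : SimpleGraph (Fin k)} [DecidableRel G.Adj]
    (hbal : StronglyBalanced G) {β : Fin k → Fin n} (hβ : Function.Injective β)
    (W : Finset (Fin n)) (F : Finset (Sym2 (Fin n))) (hF : ∀ s ∈ F, ∀ x ∈ s, x ∈ W)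
    (hW : (W ∩ univ.image β).Nonempty) :
    (k - 1) * (F ∩ G.edgeFinset.image (Sym2.map β)).card + G.edgeFinset.card ≤
      G.edgeFinset.card * (W ∩ univ.image β).card := by
  classical
  let Hs : G.Subgraph :=
    { verts := {c | β c ∈ W}
      Adj := fun a b => G.Adj a b ∧ s(β a, β b) ∈ F
      adj_sub := fun h => h.1
      edge_vert := fun h => hF _ h.2 _ (Sym2.mem_mk_left _ _)
      symm := ⟨fun a b h => ⟨h.1.symm, Sym2.eq_swap ▸ h.2⟩⟩ }
  have hv : Hs.verts.ncard = (W ∩ univ.image β).card := by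
    have h1 : W ∩ univ.image β = (univ.filter fun c => β c ∈ W).image β := by
      ext x
      simp only [mem_inter, mem_image, mem_univ, true_and, mem_filter]
      constructor
      · rintro ⟨h, c, rfl⟩
        exact ⟨c, h, rfl⟩
      · rintro ⟨c, h, rfl⟩
        exact ⟨h, c, rfl⟩
    rw [h1, card_image_of_injective _ hβ, ← Set.ncard_coe_finset]
    congr 1
    ext c
    simp [Hs]
  have he : (F ∩ G.edgeFinset.image (Sym2.map β)).card ≤ Hs.edgeSet.ncard := by
    have h1 : F ∩ G.edgeFinset.image (Sym2.map β) ⊆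
        (G.edgeFinset.filter fun s => s.map β ∈ F).image (Sym2.map β) := by
      intro s hs
      obtain ⟨h, h'⟩ := mem_inter.1 hs
      obtain ⟨t, ht, rfl⟩ := mem_image.1 h'
      exact mem_image_of_mem _ (mem_filter.2 ⟨ht, h⟩)
    refine (card_le_card h1).trans (card_image_le.trans ?_)
    rw [← Set.ncard_coe_finset]
    refine Set.ncard_le_ncard ?_ (Set.toFinite _)
    intro s hs
    induction s with
    | _ a b =>
      simpa [Hs] using hs
  have hpos := card_pos.2 hW
  rcases Nat.lt_or_ge (W ∩ univ.image β).card 2 with h1 | h2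
  · have hone : (W ∩ univ.image β).card = 1 := by omega
    have hempty : F ∩ G.edgeFinset.image (Sym2.map β) = ∅ := by
      rw [eq_empty_iff_forall_notMem]
      intro s hs
      obtain ⟨h, h'⟩ := mem_inter.1 hs
      obtain ⟨t, ht, rfl⟩ := mem_image.1 h'
      induction t with
      | _ a b =>
        rw [SimpleGraph.mem_edgeFinset, SimpleGraph.mem_edgeSet] at ht
        have hab : β a = β b := card_le_one.1 hone.le _
          (mem_inter.2 ⟨hF _ h _ (by simp), mem_image_of_mem _ (mem_univ a)⟩) _
          (mem_inter.2 ⟨hF _ h _ (by simp), mem_image_of_mem _ (mem_univ b)⟩)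
        exact ht.ne (hβ hab)
    rw [hempty, hone]
    simp
  · have := hbal Hs (hv ▸ h2)
    rw [hv] at this
    obtain ⟨m, hm⟩ := Nat.exists_eq_add_of_le' hpos
    rw [hm] at this ⊢
    calc _ ≤ (k - 1) * Hs.edgeSet.ncard + G.edgeFinset.card := by gcongr
      _ ≤ G.edgeFinset.card * m + G.edgeFinset.card := by
        rw [mul_comm (k - 1)]
        exact Nat.add_le_add_right this _
      _ = _ := by ring

/-- For copies of a strongly balanced graph whose union is connected, the number of edges lost
by overlapping is controlled by the number of vertices lost. -/
theorem StronglyBalanced.copyEdges_card_ge {j k n : ℕ} (hk : 2 ≤ k) (hj : 0 < j)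
    {G : SimpleGraph (Fin k)} [DecidableRel G.Adj]
    (hbal : StronglyBalanced G) (B : Fin j → Fin k → Fin n)
    (hB : ∀ i, Function.Injective (B i))
    (hconn : ∀ A : Finset (Fin j), A.Nonempty → Aᶜ.Nonempty →
      ∃ i ∈ A, ∃ i' ∉ A, ∃ c c', B i c = B i' c') :
    (k - 1) * (j * G.edgeFinset.card) + G.edgeFinset.card * (copyVerts B univ).card ≤
      (k - 1) * (copyEdges G B univ).card + G.edgeFinset.card * (1 + (k - 1) * j) ∧
    (copyVerts B univ).card ≤ 1 + (k - 1) * j := by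
  classical
  have main : ∀ m, 1 ≤ m → m ≤ j → ∃ A : Finset (Fin j), A.card = m ∧
      (k - 1) * (m * G.edgeFinset.card) + G.edgeFinset.card * (copyVerts B A).card ≤
      (k - 1) * (copyEdges G B A).card + G.edgeFinset.card * (1 + (k - 1) * m) ∧
      (copyVerts B A).card ≤ 1 + (k - 1) * m := by
    have hcv : ∀ i, (univ.image (B i)).card = k := fun i => by
      rw [card_image_of_injective _ (hB i), card_univ, Fintype.card_fin]
    have hce : ∀ i, (G.edgeFinset.image (Sym2.map (B i))).card = G.edgeFinset.card := fun i =>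
      card_image_of_injective _ (Sym2.map.injective (hB i))
    intro m hm
    induction m, hm using Nat.le_induction with
    | base =>
      intro _
      refine ⟨{⟨0, hj⟩}, card_singleton _, ?_⟩
      simp only [copyVerts, copyEdges, singleton_biUnion, hcv, hce]
      obtain ⟨l, rfl⟩ := Nat.exists_eq_add_of_le' hk
      constructor
      · apply le_of_eq
        rw [show l + 2 - 1 = l + 1 from rfl]
        ring
      · omega
    | succ m hm ih =>
      intro hmj
      obtain ⟨A, hA, h1, h2⟩ := ih (by omega)
      obtain ⟨i, hi, i', hi', c, c', hc⟩ := hconn A (card_pos.1 (by omega))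
        (card_pos.1 (by rw [card_compl, Fintype.card_fin]; omega))
      have hW : (copyVerts B A ∩ univ.image (B i')).Nonempty :=
        ⟨B i c, mem_inter.2 ⟨mem_biUnion.2 ⟨i, hi, mem_image_of_mem _ (mem_univ c)⟩,
          hc ▸ mem_image_of_mem _ (mem_univ c')⟩⟩
      have hov := hbal.overlap_le (hB i') (copyVerts B A) (copyEdges G B A)
        (fun s hs x hx => mem_copyVerts_of_mem_copyEdges G B A hs hx) hW
      refine ⟨insert i' A, by rw [card_insert_of_notMem hi', hA], ?_⟩
      have hV := card_union_add_card_inter (copyVerts B A) (univ.image (B i'))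
      have hE := card_union_add_card_inter (copyEdges G B A)
        (G.edgeFinset.image (Sym2.map (B i')))
      have hV' : copyVerts B (insert i' A) = copyVerts B A ∪ univ.image (B i') := by
        rw [copyVerts, biUnion_insert, union_comm]
        rfl
      have hE' : copyEdges G B (insert i' A) =
          copyEdges G B A ∪ G.edgeFinset.image (Sym2.map (B i')) := by
        rw [copyEdges, biUnion_insert, union_comm]
        rfl
      rw [hcv] at hV
      rw [hce] at hE
      rw [hV', hE']
      have hWpos := card_pos.2 hW
      obtain ⟨l, rfl⟩ := Nat.exists_eq_add_of_le' hk
      simp only [show l + 2 - 1 = l + 1 from rfl] at *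
      constructor
      · zify at *
        generalize (G.edgeFinset.card : ℤ) = e at *
        nlinarith
      · have : (l + 1) * (m + 1) = (l + 1) * m + (l + 1) := by ring
        omega
  obtain ⟨A, hA, h⟩ := main j hj le_rfl
  rwa [(card_eq_iff_eq_univ A).1 (by rw [hA, Fintype.card_fin])] at h

theorem cum_comp_eq_cum_map {Ω E : Type*} [MeasurableSpace Ω] [MeasurableSpace E]
    (P : Measure Ω) {T : Ω → E} (hT : AEMeasurable T P) {W : E → ℝ} (hW : Measurable W) (j : ℕ) :
    cum P j (fun ω => W (T ω)) = cum (P.map T) j W := by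
  unfold cum jointCumulant
  refine sum_congr rfl fun σ _ => ?_
  congr 1
  refine prod_congr rfl fun b _ => ?_
  rw [integral_map hT]
  exact (Finset.measurable_fun_prod b fun _ _ => hW).aestronglyMeasurable

theorem prod_parts_integral_eq {Ω : Type*} [MeasurableSpace Ω] (ν : Measure Ω)
    [IsProbabilityMeasure ν] {j : ℕ} (σ : Finpartition (univ : Finset (Fin j)))
    (V : Fin j → Ω → ℝ) :
    ∏ b ∈ σ.parts, ∫ ω, ∏ i ∈ b, V i ω ∂ν =
      ∫ x : σ.parts → Ω, ∏ i, V i (x ⟨σ.part i, σ.part_mem.2 (mem_univ i)⟩)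
        ∂(Measure.pi fun _ => ν) := by
  rw [← prod_coe_sort, ← integral_fintype_prod_eq_prod (μ := fun _ : σ.parts => ν)
    (f := fun (b : σ.parts) ω => ∏ i ∈ b.1, V i ω)]
  congr 1
  funext x
  rw [← prod_fiberwise univ
    (fun i => (⟨σ.part i, σ.part_mem.2 (mem_univ i)⟩ : σ.parts))]
  refine prod_congr rfl fun b _ => ?_
  have hb : univ.filter (fun i => (⟨σ.part i, σ.part_mem.2 (mem_univ i)⟩ : σ.parts) = b) =
      b.1 := by
    ext i
    simp only [mem_filter, mem_univ, true_and, Subtype.ext_iff]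
    exact σ.part_eq_iff_mem b.2
  conv_lhs => rw [← hb]
  refine prod_congr rfl fun i hi => ?_
  rw [(mem_filter.1 hi).2]

/-- Multilinear expansion of the cumulants of a finite sum of bounded random variables. -/
theorem cum_const_mul_sum {Ω ι : Type*} [MeasurableSpace Ω] (ν : Measure Ω)
    [IsProbabilityMeasure ν] (S : Finset ι) (Z : ι → Ω → ℝ) (hZ : ∀ β, Measurable (Z β))
    (hZ1 : ∀ β ω, |Z β ω| ≤ 1) (c : ℝ) (j : ℕ) :
    cum ν j (fun ω => c * ∑ β ∈ S, Z β ω) =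
      c ^ j * ∑ B ∈ Fintype.piFinset (fun _ : Fin j => S),
        jointCumulant ν (fun i => Z (B i)) := by
  unfold cum jointCumulant
  rw [sum_comm, mul_sum]
  refine sum_congr rfl fun σ _ => ?_
  rw [← mul_sum, mul_left_comm]
  congr 1
  rw [prod_parts_integral_eq]
  simp_rw [prod_parts_integral_eq ν σ]
  rw [← integral_finsetSum, ← integral_const_mul]
  · congr 1
    funext x
    rw [prod_mul_distrib, prod_const, card_univ, Fintype.card_fin, prod_univ_sum]
  · intro B _
    refine Integrable.of_bound (C := 1) ?_ (Filter.Eventually.of_forall fun x => ?_)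
    · exact (Finset.measurable_fun_prod _ fun i _ =>
        (hZ (B i)).comp (measurable_pi_apply _)).aestronglyMeasurable
    · rw [norm_prod]
      exact prod_le_one (fun _ _ => norm_nonneg _) fun i _ => hZ1 _ _

/-- Functions of disjoint sets of coordinates are uncorrelated under a product measure. -/
theorem integral_pi_mul_of_dependsOn {ι E : Type*} [Fintype ι] [MeasurableSpace E] [Nonempty E]
    (μ : Measure E) [IsProbabilityMeasure μ] {f g : (ι → E) → ℝ} (hf : Measurable f)
    (hg : Measurable g) {S T : Finset ι} (hST : Disjoint S T)
    (hfS : DependsOn f S) (hgT : DependsOn g T) :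
    ∫ x, f x * g x ∂(Measure.pi fun _ => μ) =
      (∫ x, f x ∂(Measure.pi fun _ => μ)) * ∫ x, g x ∂(Measure.pi fun _ => μ) := by
  classical
  let ext : ∀ U : Finset ι, (U → E) → ι → E :=
    fun U x i => if h : i ∈ U then x ⟨i, h⟩ else Classical.arbitrary E
  have hext : ∀ U, Measurable (ext U) := fun U => by
    refine measurable_pi_lambda _ fun i => ?_
    by_cases h : i ∈ U
    · simpa [ext, h] using measurable_pi_apply _
    · simp [ext, h]
  have hind : iIndepFun (fun i (x : ι → E) => x i) (Measure.pi fun _ : ι => μ) :=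
    iIndepFun_pi (X := fun _ : ι => (id : E → E)) fun _ => aemeasurable_id
  have h := (hind.indepFun_finset S T hST fun i => measurable_pi_apply i).comp
    (hf.comp (hext S)) (hg.comp (hext T))
  have hf' : ∀ x : ι → E, f (ext S fun i => x i) = f x := fun x =>
    hfS fun i hi => by simp [ext, mem_coe.1 hi]
  have hg' : ∀ x : ι → E, g (ext T fun i => x i) = g x := fun x =>
    hgT fun i hi => by simp [ext, mem_coe.1 hi]
  have h2 := h.integral_fun_mul_eq_mul_integral
    ((hf.comp (hext S)).comp (by fun_prop)).aestronglyMeasurable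
    ((hg.comp (hext T)).comp (by fun_prop)).aestronglyMeasurable
  simpa only [Function.comp_apply, hf', hg'] using h2

/-- The indicator that all the pairs in `U` are adjacent. -/
noncomputable def edgeInd {d n : ℕ} (H : (Fin d → ℝ) → (Fin d → ℝ) → ℝ) (pn : ℝ)
    (U : Finset (Sym2 (Fin n)))
    (z : (Fin n → Fin d → ℝ) × ({q : Fin n × Fin n // q.1 < q.2} → ℝ)) : ℝ :=
  ∏ q : {q : Fin n × Fin n // q.1 < q.2}, if s(q.1.1, q.1.2) ∈ U then
    (if z.2 q ≤ pn * H (z.1 q.1.1) (z.1 q.1.2) then 1 else 0) else 1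

/-- The conditional probability, given the vertex positions, that all the pairs in `U` are
adjacent. -/
noncomputable def edgeProb {d n : ℕ} (H : (Fin d → ℝ) → (Fin d → ℝ) → ℝ) (pn : ℝ)
    (U : Finset (Sym2 (Fin n))) (x : Fin n → Fin d → ℝ) : ℝ :=
  ∏ q : {q : Fin n × Fin n // q.1 < q.2}, if s(q.1.1, q.1.2) ∈ U then
    pn * H (x q.1.1) (x q.1.2) else 1

section EdgeInd

variable {d n : ℕ} {H : (Fin d → ℝ) → (Fin d → ℝ) → ℝ} {pn : ℝ}

open Classical in
theorem edgeInd_eq_ite (U : Finset (Sym2 (Fin n)))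
    (z : (Fin n → Fin d → ℝ) × ({q : Fin n × Fin n // q.1 < q.2} → ℝ)) :
    edgeInd H pn U z = if ∀ q : {q : Fin n × Fin n // q.1 < q.2}, s(q.1.1, q.1.2) ∈ U →
      z.2 q ≤ pn * H (z.1 q.1.1) (z.1 q.1.2) then 1 else 0 := by
  have h : ∀ q : {q : Fin n × Fin n // q.1 < q.2}, (if s(q.1.1, q.1.2) ∈ U then
      (if z.2 q ≤ pn * H (z.1 q.1.1) (z.1 q.1.2) then (1 : ℝ) else 0) else 1) =
      if s(q.1.1, q.1.2) ∈ U → z.2 q ≤ pn * H (z.1 q.1.1) (z.1 q.1.2) then 1 else 0 := by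
    intro q
    by_cases h : s(q.1.1, q.1.2) ∈ U <;> simp [h]
  simp_rw [edgeInd, h]
  rw [prod_boole]
  simp

theorem edgeInd_biUnion {ι : Type*} (b : Finset ι) (U : ι → Finset (Sym2 (Fin n)))
    (z : (Fin n → Fin d → ℝ) × ({q : Fin n × Fin n // q.1 < q.2} → ℝ)) :
    edgeInd H pn (b.biUnion U) z = ∏ i ∈ b, edgeInd H pn (U i) z := by
  classical
  simp_rw [edgeInd_eq_ite]
  rw [prod_boole]
  congr 1
  simp only [mem_biUnion, eq_iff_iff]
  exact ⟨fun h i hi q hq => h q ⟨i, hi, hq⟩, fun h q ⟨i, hi, hq⟩ => h i hi q hq⟩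

theorem prod_edges_eq_edgeInd {k : ℕ} (G : SimpleGraph (Fin k)) [DecidableRel G.Adj]
    (hHsym : ∀ x y, H x y = H y x) (x : Fin n → Fin d → ℝ) (y : Fin n → Fin n → ℝ)
    (hy : ∀ a b, y a b = y b a) {β : Fin k → Fin n} (hβ : Function.Injective β) :
    (∏ q ∈ (univ : Finset (Fin k × Fin k)).filter (fun q => q.1 < q.2 ∧ G.Adj q.1 q.2),
      if y (β q.1) (β q.2) ≤ pn * H (x (β q.1)) (x (β q.2)) then (1 : ℝ) else 0) =
      edgeInd H pn (G.edgeFinset.image (Sym2.map β)) (x, fun q => y q.1.1 q.1.2) := by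
  classical
  rw [edgeInd_eq_ite, prod_boole]
  congr 1
  simp only [mem_filter, mem_univ, true_and, eq_iff_iff]
  constructor
  · rintro h ⟨⟨u, v⟩, huv⟩ hs
    obtain ⟨t, ht, hts⟩ := mem_image.1 hs
    induction t with
    | _ a b =>
      rw [SimpleGraph.mem_edgeFinset, SimpleGraph.mem_edgeSet] at ht
      have hab : y (β a) (β b) ≤ pn * H (x (β a)) (x (β b)) := by
        rcases lt_or_gt_of_ne ht.ne with hlt | hlt
        · exact h (a, b) ⟨hlt, ht⟩
        · rw [hy, hHsym]
          exact h (b, a) ⟨hlt, ht.symm⟩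
      simp only [Sym2.map_mk, Sym2.eq_iff] at hts
      rcases hts with ⟨rfl, rfl⟩ | ⟨rfl, rfl⟩
      · exact hab
      · rwa [hy, hHsym] at hab
  · rintro h ⟨a, b⟩ ⟨_, hab⟩
    have hmem : s(β a, β b) ∈ G.edgeFinset.image (Sym2.map β) :=
      mem_image.2 ⟨s(a, b), by simpa using hab, by simp⟩
    rcases lt_or_gt_of_ne (hβ.ne hab.ne) with hlt | hlt
    · exact h ⟨(β a, β b), hlt⟩ hmem
    · have := h ⟨(β b, β a), hlt⟩ (Sym2.eq_swap ▸ hmem)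
      rwa [hy, hHsym] at this

theorem measurable_edgeInd (hHm : Measurable fun z : (Fin d → ℝ) × (Fin d → ℝ) => H z.1 z.2)
    (U : Finset (Sym2 (Fin n))) : Measurable (edgeInd H pn U) := by
  refine Finset.measurable_fun_prod _ fun q _ => ?_
  split_ifs
  · refine Measurable.ite (measurableSet_le ?_ ?_) measurable_const measurable_const
    · fun_prop
    · exact (hHm.comp (f := fun z : (Fin n → Fin d → ℝ) ×
        ({q : Fin n × Fin n // q.1 < q.2} → ℝ) => (z.1 q.1.1, z.1 q.1.2))
        (by fun_prop)).const_mul pn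
  · exact measurable_const

theorem measurable_edgeProb (hHm : Measurable fun z : (Fin d → ℝ) × (Fin d → ℝ) => H z.1 z.2)
    (U : Finset (Sym2 (Fin n))) : Measurable (edgeProb H pn U) := by
  refine Finset.measurable_fun_prod _ fun q _ => ?_
  split_ifs
  · exact (hHm.comp (f := fun x : Fin n → Fin d → ℝ => (x q.1.1, x q.1.2))
      (by fun_prop)).const_mul pn
  · exact measurable_const

theorem abs_edgeInd_le_one (U : Finset (Sym2 (Fin n)))
    (z : (Fin n → Fin d → ℝ) × ({q : Fin n × Fin n // q.1 < q.2} → ℝ)) :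
    |edgeInd H pn U z| ≤ 1 := by
  classical
  rw [edgeInd_eq_ite]
  split_ifs <;> simp

theorem integral_Icc_ite_le {c : ℝ} (hc : c ∈ Set.Icc (0 : ℝ) 1) :
    ∫ y, (if y ≤ c then (1 : ℝ) else 0) ∂(volume.restrict (Set.Icc (0 : ℝ) 1)) = c := by
  have h : (fun y : ℝ => if y ≤ c then (1 : ℝ) else 0) = (Set.Iic c).indicator 1 := by
    funext y
    simp [Set.indicator_apply]
  have hI : Set.Iic c ∩ Set.Icc 0 1 = Set.Icc 0 c := by
    ext y
    simp only [Set.mem_inter_iff, Set.mem_Iic, Set.mem_Icc]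
    exact ⟨fun hy => ⟨hy.2.1, hy.1⟩, fun hy => ⟨hy.2, hy.1, hy.2.trans hc.2⟩⟩
  rw [h, integral_indicator_one measurableSet_Iic, measureReal_restrict_apply measurableSet_Iic,
    hI, Real.volume_real_Icc_of_le hc.1, sub_zero]

variable (μ : Measure (Fin d → ℝ)) [IsProbabilityMeasure μ]

theorem isProbabilityMeasure_restrict_Icc :
    IsProbabilityMeasure (volume.restrict (Set.Icc (0 : ℝ) 1)) :=
  ⟨by simp⟩

theorem integral_edgeInd
    (hHm : Measurable fun z : (Fin d → ℝ) × (Fin d → ℝ) => H z.1 z.2)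
    (hH01 : ∀ x y, H x y ∈ Set.Icc (0 : ℝ) 1) (hp : pn ∈ Set.Ioo (0 : ℝ) 1)
    (U : Finset (Sym2 (Fin n))) :
    ∫ z, edgeInd H pn U z ∂((Measure.pi fun _ => μ).prod
          (Measure.pi fun _ => (volume.restrict (Set.Icc (0 : ℝ) 1)))) =
      ∫ x, edgeProb H pn U x ∂(Measure.pi fun _ => μ) := by
  have := isProbabilityMeasure_restrict_Icc
  rw [integral_prod]
  · congr 1
    funext x
    refine (integral_fintype_prod_eq_prod
      (μ := fun _ : {q : Fin n × Fin n // q.1 < q.2} => volume.restrict (Set.Icc (0 : ℝ) 1))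
      (f := fun q y => if s(q.1.1, q.1.2) ∈ U then
        (if y ≤ pn * H (x q.1.1) (x q.1.2) then (1 : ℝ) else 0) else 1)).trans ?_
    refine prod_congr rfl fun q _ => ?_
    split_ifs
    · have hH := hH01 (x q.1.1) (x q.1.2)
      exact integral_Icc_ite_le ⟨mul_nonneg hp.1.le hH.1, mul_le_one₀ hp.2.le hH.1 hH.2⟩
    · simp
  · exact Integrable.of_bound (C := 1) (measurable_edgeInd hHm U).aestronglyMeasurable
      (Filter.Eventually.of_forall fun z => abs_edgeInd_le_one U z)

theorem edgeProb_nonneg (hH01 : ∀ x y, H x y ∈ Set.Icc (0 : ℝ) 1) (hp : pn ∈ Set.Ioo (0 : ℝ) 1)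
    (U : Finset (Sym2 (Fin n))) (x : Fin n → Fin d → ℝ) : 0 ≤ edgeProb H pn U x := by
  refine prod_nonneg fun q _ => ?_
  split_ifs
  · exact mul_nonneg hp.1.le (hH01 _ _).1
  · exact zero_le_one

theorem edgeProb_le (hH01 : ∀ x y, H x y ∈ Set.Icc (0 : ℝ) 1) (hp : pn ∈ Set.Ioo (0 : ℝ) 1)
    {U : Finset (Sym2 (Fin n))} (hU : ∀ s ∈ U, ¬ s.IsDiag) (x : Fin n → Fin d → ℝ) :
    edgeProb H pn U x ≤ pn ^ U.card := by
  have h1 : edgeProb H pn U x ≤ ∏ q : {q : Fin n × Fin n // q.1 < q.2},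
      if s(q.1.1, q.1.2) ∈ U then pn else 1 := by
    refine prod_le_prod (fun q _ => ?_) fun q _ => ?_
    · split_ifs
      · exact mul_nonneg hp.1.le (hH01 _ _).1
      · exact zero_le_one
    · split_ifs
      · exact mul_le_of_le_one_right hp.1.le (hH01 _ _).2
      · exact le_rfl
  rw [prod_ite, prod_const, prod_const_one, mul_one] at h1
  refine h1.trans (pow_le_pow_of_le_one hp.1.le hp.2.le ?_)
  refine card_le_card_of_surjOn
    (fun q : {q : Fin n × Fin n // q.1 < q.2} => s(q.1.1, q.1.2)) fun s hs => ?_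
  have hd := hU s hs
  induction s with
  | _ a b =>
    rw [Sym2.mk_isDiag_iff] at hd
    rcases lt_or_gt_of_ne hd with hlt | hlt
    · exact ⟨⟨(a, b), hlt⟩, by simpa using hs, rfl⟩
    · exact ⟨⟨(b, a), hlt⟩, by simpa [Sym2.eq_swap] using hs, Sym2.eq_swap⟩

theorem integral_edgeProb_le
    (hH01 : ∀ x y, H x y ∈ Set.Icc (0 : ℝ) 1) (hp : pn ∈ Set.Ioo (0 : ℝ) 1)
    {U : Finset (Sym2 (Fin n))} (hU : ∀ s ∈ U, ¬ s.IsDiag) :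
    ∫ x, edgeProb H pn U x ∂(Measure.pi fun _ => μ) ≤ pn ^ U.card := by
  refine (integral_mono_of_nonneg
    (Filter.Eventually.of_forall fun x => edgeProb_nonneg hH01 hp U x)
    (integrable_const (pn ^ U.card))
    (Filter.Eventually.of_forall fun x => edgeProb_le hH01 hp hU x)).trans ?_
  simp

theorem dependsOn_edgeProb {U : Finset (Sym2 (Fin n))} {W : Finset (Fin n)}
    (hU : ∀ s ∈ U, ∀ v ∈ s, v ∈ W) : DependsOn (edgeProb H pn U) W := by
  intro x x' h
  refine prod_congr rfl fun q _ => ?_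
  split_ifs with hq
  · rw [h _ (mem_coe.2 (hU _ hq _ (Sym2.mem_mk_left _ _))),
      h _ (mem_coe.2 (hU _ hq _ (Sym2.mem_mk_right _ _)))]
  · rfl

theorem integral_edgeProb_union
    (hHm : Measurable fun z : (Fin d → ℝ) × (Fin d → ℝ) => H z.1 z.2)
    {U₁ U₂ : Finset (Sym2 (Fin n))} {W₁ W₂ : Finset (Fin n)} (hW : Disjoint W₁ W₂)
    (hU₁ : ∀ s ∈ U₁, ∀ v ∈ s, v ∈ W₁) (hU₂ : ∀ s ∈ U₂, ∀ v ∈ s, v ∈ W₂) :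
    ∫ x, edgeProb H pn (U₁ ∪ U₂) x ∂(Measure.pi fun _ => μ) =
      (∫ x, edgeProb H pn U₁ x ∂(Measure.pi fun _ => μ)) *
        ∫ x, edgeProb H pn U₂ x ∂(Measure.pi fun _ => μ) := by
  rw [← integral_pi_mul_of_dependsOn μ (measurable_edgeProb hHm U₁) (measurable_edgeProb hHm U₂)
    hW (dependsOn_edgeProb hU₁) (dependsOn_edgeProb hU₂)]
  congr 1
  funext x
  rw [edgeProb, edgeProb, edgeProb, ← prod_mul_distrib]
  refine prod_congr rfl fun q _ => ?_
  by_cases h1 : s(q.1.1, q.1.2) ∈ U₁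
  · have h2 : s(q.1.1, q.1.2) ∉ U₂ := fun h2 => disjoint_left.1 hW
      (hU₁ _ h1 _ (Sym2.mem_mk_left _ _)) (hU₂ _ h2 _ (Sym2.mem_mk_left _ _))
    simp [h1, h2]
  · by_cases h2 : s(q.1.1, q.1.2) ∈ U₂ <;> simp [h1, h2]

end EdgeInd

theorem pow_le_of_one_le_mul_rpow {k n e E M j : ℕ} {q : ℝ} (hk : 2 ≤ k)
    (hq : q ∈ Set.Ioo (0 : ℝ) 1) (h1 : 1 ≤ (n : ℝ) * q ^ ((e : ℝ) / ((k : ℝ) - 1)))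
    (hE : (k - 1) * (j * e) ≤ (k - 1) * E + e * M) :
    q ^ E ≤ (n : ℝ) ^ M * q ^ (j * e) := by
  have hk1 : (0 : ℝ) < (k : ℝ) - 1 := by
    have : (2 : ℝ) ≤ k := by exact_mod_cast hk
    linarith
  have hE' : ((k : ℝ) - 1) * (j * e) ≤ ((k : ℝ) - 1) * E + e * M := by
    have : (((k - 1 : ℕ) : ℝ)) = (k : ℝ) - 1 := by
      rw [Nat.cast_sub (by omega), Nat.cast_one]
    rw [← this]
    exact_mod_cast hE
  have hexp : ((j * e : ℕ) : ℝ) ≤ E + (e : ℝ) / ((k : ℝ) - 1) * M := by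
    refine le_of_mul_le_mul_left ?_ hk1
    push_cast
    refine hE'.trans (le_of_eq ?_)
    field_simp
  calc q ^ E ≤ q ^ E * ((n : ℝ) * q ^ ((e : ℝ) / ((k : ℝ) - 1))) ^ M :=
        le_mul_of_one_le_right (pow_nonneg hq.1.le _) (one_le_pow₀ h1)
    _ = (n : ℝ) ^ M * q ^ ((E : ℝ) + (e : ℝ) / ((k : ℝ) - 1) * M) := by
        rw [mul_pow, Real.rpow_add hq.1, Real.rpow_mul hq.1.le, Real.rpow_natCast,
          Real.rpow_natCast]
        ring
    _ ≤ (n : ℝ) ^ M * q ^ (j * e) := by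
        rw [← Real.rpow_natCast q (j * e)]
        exact mul_le_mul_of_nonneg_left (Real.rpow_le_rpow_of_exponent_ge hq.1 hq.2.le hexp)
          (pow_nonneg (Nat.cast_nonneg _) _)

/-- A joint cumulant is bounded by `j ^ (j - 1)` times a common bound for its moment products. -/
theorem abs_jointCumulant_le {Ω : Type*} [MeasurableSpace Ω] (P : Measure Ω) {j : ℕ} (hj : 0 < j)
    (Z : Fin j → Ω → ℝ) {c : ℝ} (hc : 0 ≤ c)
    (h : ∀ σ : Finpartition (univ : Finset (Fin j)),
      |∏ b ∈ σ.parts, ∫ ω, ∏ i ∈ b, Z i ω ∂P| ≤ c) :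
    |jointCumulant P Z| ≤ (j : ℝ) ^ (j - 1) * c := by
  refine (abs_sum_le_sum_abs _ _).trans
    (le_trans ?_ (mul_le_mul_of_nonneg_right (sum_finpartition_factorial_le hj) hc))
  rw [sum_mul]
  refine sum_le_sum fun σ _ => ?_
  rw [abs_mul, abs_mul, abs_pow, abs_neg, abs_one, one_pow, one_mul, Nat.abs_cast]
  exact mul_le_mul_of_nonneg_left (h σ) (Nat.cast_nonneg _)

theorem jointCumulant_eq_zero {Ω : Type*} [MeasurableSpace Ω] (P : Measure Ω)
    [IsProbabilityMeasure P] {j : ℕ} (Z : Fin j → Ω → ℝ) (A : Finset (Fin j)) (hA : A.Nonempty)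
    (hA' : Aᶜ.Nonempty)
    (hfac : ∀ b : Finset (Fin j), ∫ ω, ∏ i ∈ b, Z i ω ∂P =
      (∫ ω, ∏ i ∈ b.filter (· ∈ A), Z i ω ∂P) * ∫ ω, ∏ i ∈ b.filter (· ∉ A), Z i ω ∂P) :
    jointCumulant P Z = 0 :=
  sum_finpartition_eq_zero_of_factorization (fun b => ∫ ω, ∏ i ∈ b, Z i ω ∂P) (by simp)
    A hA hA' hfac

theorem not_isDiag_of_mem_copyEdges {j k n : ℕ} (G : SimpleGraph (Fin k)) [DecidableRel G.Adj]
    (B : Fin j → Fin k → Fin n) (hB : ∀ i, Function.Injective (B i)) (A : Finset (Fin j)) :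
    ∀ s ∈ copyEdges G B A, ¬ s.IsDiag := by
  intro s hs
  obtain ⟨i, _, hi⟩ := mem_biUnion.1 hs
  obtain ⟨t, ht, rfl⟩ := mem_image.1 hi
  induction t with
  | _ a b =>
    rw [SimpleGraph.mem_edgeFinset, SimpleGraph.mem_edgeSet] at ht
    rw [Sym2.map_mk, Sym2.mk_isDiag_iff]
    exact (hB i).ne ht.ne

theorem copyEdges_filter_union {j k n : ℕ} (G : SimpleGraph (Fin k)) [DecidableRel G.Adj]
    (B : Fin j → Fin k → Fin n) (A b : Finset (Fin j)) :
    copyEdges G B b = copyEdges G B (b.filter (· ∈ A)) ∪ copyEdges G B (b.filter (· ∉ A)) := by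
  simp only [copyEdges]
  rw [← union_biUnion, filter_union_filter_not_eq]

theorem card_copyEdges_univ_le {j k n : ℕ} (G : SimpleGraph (Fin k)) [DecidableRel G.Adj]
    (B : Fin j → Fin k → Fin n) (σ : Finpartition (univ : Finset (Fin j))) :
    (copyEdges G B univ).card ≤ ∑ b ∈ σ.parts, (copyEdges G B b).card := by
  refine le_trans (card_le_card ?_) card_biUnion_le
  intro s hs
  obtain ⟨i, _, hi⟩ := mem_biUnion.1 hs
  exact mem_biUnion.2 ⟨σ.part i, σ.part_mem.2 (mem_univ i),
    mem_biUnion.2 ⟨i, σ.mem_part (mem_univ i), hi⟩⟩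

theorem copyVerts_univ_eq_image {j k n : ℕ} (B : Fin j → Fin k → Fin n) :
    copyVerts B univ = univ.image fun q : Fin j × Fin k => B q.1 q.2 := by
  ext v
  simp [copyVerts]

/-- The joint cumulant of the indicators of given copies of a strongly balanced graph. -/
theorem abs_jointCumulant_edgeInd_le {d k n j : ℕ} (hk : 2 ≤ k) (hj : 0 < j) (hn : 0 < n)
    (G : SimpleGraph (Fin k)) [DecidableRel G.Adj] (hbal : StronglyBalanced G)
    (μ : Measure (Fin d → ℝ)) [IsProbabilityMeasure μ]
    (H : (Fin d → ℝ) → (Fin d → ℝ) → ℝ)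
    (hHm : Measurable fun z : (Fin d → ℝ) × (Fin d → ℝ) => H z.1 z.2)
    (hH01 : ∀ x y, H x y ∈ Set.Icc (0 : ℝ) 1) {pn : ℝ} (hp : pn ∈ Set.Ioo (0 : ℝ) 1)
    (h1 : 1 ≤ (n : ℝ) * pn ^ ((G.edgeFinset.card : ℝ) / ((k : ℝ) - 1)))
    (B : Fin j → Fin k → Fin n) (hB : ∀ i, Function.Injective (B i)) :
    |jointCumulant ((Measure.pi fun _ => μ).prod
          (Measure.pi fun _ => (volume.restrict (Set.Icc (0 : ℝ) 1))))
        (fun i => edgeInd H pn (G.edgeFinset.image (Sym2.map (B i))))| ≤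
      (j : ℝ) ^ (j - 1) * (((n : ℝ) ^ (1 + (k - 1) * j) * pn ^ (j * G.edgeFinset.card)) *
        ((n : ℝ) ^ (univ.image fun q : Fin j × Fin k => B q.1 q.2).card)⁻¹) := by
  have := isProbabilityMeasure_restrict_Icc
  have hn0 : (0 : ℝ) < n := by exact_mod_cast hn
  have hbound : 0 ≤ ((n : ℝ) ^ (1 + (k - 1) * j) * pn ^ (j * G.edgeFinset.card)) *
      ((n : ℝ) ^ (univ.image fun q : Fin j × Fin k => B q.1 q.2).card)⁻¹ := by
    have := hp.1
    positivity
  have hmom : ∀ b : Finset (Fin j),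
      ∫ z, ∏ i ∈ b, edgeInd H pn (G.edgeFinset.image (Sym2.map (B i))) z
        ∂((Measure.pi fun _ => μ).prod
          (Measure.pi fun _ => (volume.restrict (Set.Icc (0 : ℝ) 1)))) =
      ∫ x, edgeProb H pn (copyEdges G B b) x ∂(Measure.pi fun _ => μ) := by
    intro b
    rw [← integral_edgeInd μ hHm hH01 hp]
    simp_rw [copyEdges, edgeInd_biUnion]
  by_cases hconn : ∀ A : Finset (Fin j), A.Nonempty → Aᶜ.Nonempty →
      ∃ i ∈ A, ∃ i' ∉ A, ∃ c c', B i c = B i' c'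
  · refine abs_jointCumulant_le _ hj _ hbound fun σ => ?_
    obtain ⟨hE, hV⟩ := hbal.copyEdges_card_ge hk hj B hB hconn
    obtain ⟨M, hM⟩ := Nat.exists_eq_add_of_le hV
    simp_rw [hmom]
    rw [abs_prod]
    calc ∏ b ∈ σ.parts, |∫ x, edgeProb H pn (copyEdges G B b) x ∂(Measure.pi fun _ => μ)|
        ≤ ∏ b ∈ σ.parts, pn ^ (copyEdges G B b).card := by
          refine prod_le_prod (fun _ _ => abs_nonneg _) fun b _ => ?_
          rw [abs_of_nonneg (integral_nonneg fun x => edgeProb_nonneg hH01 hp _ x)]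
          exact integral_edgeProb_le μ hH01 hp (not_isDiag_of_mem_copyEdges G B hB b)
      _ ≤ pn ^ (copyEdges G B univ).card := by
          rw [prod_pow_eq_pow_sum]
          exact pow_le_pow_of_le_one hp.1.le hp.2.le (card_copyEdges_univ_le G B σ)
      _ ≤ (n : ℝ) ^ M * pn ^ (j * G.edgeFinset.card) := by
          refine pow_le_of_one_le_mul_rpow hk hp h1 ?_
          rw [hM, mul_add] at hE
          omega
      _ = _ := by
          rw [hM, ← copyVerts_univ_eq_image, pow_add]
          field_simp
  · push Not at hconn
    obtain ⟨A, hA, hA', hdisj⟩ := hconn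
    rw [jointCumulant_eq_zero _ _ A hA hA', abs_zero]
    · positivity
    · intro b
      rw [hmom, hmom, hmom, copyEdges_filter_union G B A b]
      refine integral_edgeProb_union μ hHm ?_
        (fun s hs v hv => mem_copyVerts_of_mem_copyEdges G B _ hs hv)
        (fun s hs v hv => mem_copyVerts_of_mem_copyEdges G B _ hs hv)
      rw [disjoint_left]
      intro v hv hv'
      simp only [copyVerts, mem_biUnion, mem_filter, mem_image, mem_univ, true_and] at hv hv'
      obtain ⟨i, hi, c, rfl⟩ := hv
      obtain ⟨i', hi', c', hc'⟩ := hv'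
      exact hdisj i hi.2 i' hi'.2 c c' hc'.symm

/-- Cumulant growth rate for the counts of strongly balanced connected graphs in the
dense regime `n^{−(v(G)−1)/e(G)} ≪ p_n`: for `n` large enough and all `j ≥ 2`,
`|κ_j(N_G)| ≤ j^{j−1} (j!)^{v(G)} (v(G)!)^{j−1} a(G)^{−j} n^{1+(v(G)−1)j} p_n^{j·e(G)}`. -/
theorem cumulant_growth_dense
    {d k : ℕ} (hk : 2 ≤ k)
    (G : SimpleGraph (Fin k)) [DecidableRel G.Adj] (hGconn : G.Connected)
    (μ : Measure (Fin d → ℝ)) [IsProbabilityMeasure μ] (hμ : ∀ x, μ {x} = 0)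
    (H : (Fin d → ℝ) → (Fin d → ℝ) → ℝ)
    (hHm : Measurable fun z : (Fin d → ℝ) × (Fin d → ℝ) => H z.1 z.2)
    (hHsym : ∀ x y, H x y = H y x) (hH01 : ∀ x y, H x y ∈ Set.Icc (0 : ℝ) 1)
    (p : ℕ → ℝ) (hp : ∀ n, p n ∈ Set.Ioo (0 : ℝ) 1)
    (Ω : ℕ → Type) [∀ n, MeasurableSpace (Ω n)]
    (P : ∀ n, Measure (Ω n)) [∀ n, IsProbabilityMeasure (P n)]
    (X : ∀ n, Fin n → Ω n → (Fin d → ℝ)) (Y : ∀ n, Fin n → Fin n → Ω n → ℝ)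
    (hYsym : ∀ n a b, Y n a b = Y n b a)
    (hlaw : ∀ n, Measure.map (fun ω => ((fun i => X n i ω),
        (fun q : {q : Fin n × Fin n // q.1 < q.2} => Y n q.1.1 q.1.2 ω))) (P n)
      = (Measure.pi fun _ => μ).prod
          (Measure.pi fun _ => (volume.restrict (Set.Icc (0 : ℝ) 1))))
    (hbal : StronglyBalanced G)
    (hgrow : Filter.Tendsto
      (fun n : ℕ => (n : ℝ) * p n ^ ((G.edgeFinset.card : ℝ) / ((k : ℝ) - 1)))
      Filter.atTop Filter.atTop) :
    ∃ n₀ : ℕ, ∀ n, n₀ ≤ n → ∀ j, 2 ≤ j →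
      |cum (P n) j (NG G H (p n) (autCard G) (X n) (Y n))|
        ≤ (j : ℝ) ^ (j - 1) * (j.factorial : ℝ) ^ k * (k.factorial : ℝ) ^ (j - 1)
            / (autCard G : ℝ) ^ j
            * (n : ℝ) ^ (1 + (k - 1) * j) * p n ^ (j * G.edgeFinset.card) := by
  obtain ⟨n₀, hn₀⟩ := Filter.eventually_atTop.1 (hgrow.eventually_ge_atTop 1)
  refine ⟨max n₀ 1, fun n hn j hj => ?_⟩
  have h1 := hn₀ n ((le_max_left _ _).trans hn)
  have hnpos : 0 < n := (le_max_right n₀ 1).trans hn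
  have hj0 : 0 < j := by omega
  have := isProbabilityMeasure_restrict_Icc
  have hpn := (hp n).1
  let W : (Fin n → Fin d → ℝ) × ({q : Fin n × Fin n // q.1 < q.2} → ℝ) → ℝ := fun z =>
    (autCard G : ℝ)⁻¹ * ∑ β ∈ (univ : Finset (Fin k → Fin n)).filter Function.Injective,
      edgeInd H (p n) (G.edgeFinset.image (Sym2.map β)) z
  have hNG : NG G H (p n) (autCard G) (X n) (Y n) = fun ω => W ((fun i => X n i ω),
      (fun q : {q : Fin n × Fin n // q.1 < q.2} => Y n q.1.1 q.1.2 ω)) := by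
    funext ω
    simp only [NG, W]
    congr 1
    refine sum_congr rfl fun β hβ => ?_
    exact prod_edges_eq_edgeInd G hHsym (fun i => X n i ω) (fun a b => Y n a b ω)
      (fun a b => by rw [hYsym]) (mem_filter.1 hβ).2
  have hW : Measurable W := (Finset.measurable_fun_sum _ fun β _ =>
    measurable_edgeInd hHm _).const_mul _
  have hT : AEMeasurable (fun ω => ((fun i => X n i ω),
      (fun q : {q : Fin n × Fin n // q.1 < q.2} => Y n q.1.1 q.1.2 ω))) (P n) :=
    AEMeasurable.of_map_ne_zero (by rw [hlaw]; exact IsProbabilityMeasure.ne_zero _)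
  rw [hNG, cum_comp_eq_cum_map (P n) hT hW, hlaw, cum_const_mul_sum _ _ _
    (fun β => measurable_edgeInd hHm _) (fun β z => abs_edgeInd_le_one _ z), abs_mul,
    abs_of_nonneg (by positivity)]
  have hset : Fintype.piFinset (fun _ : Fin j =>
      (univ : Finset (Fin k → Fin n)).filter Function.Injective) =
      univ.filter fun B => ∀ r, Function.Injective (B r) := by
    ext B
    simp
  rw [hset]
  calc (autCard G : ℝ)⁻¹ ^ j * |_|
      ≤ (autCard G : ℝ)⁻¹ ^ j * ∑ B ∈ (univ : Finset (Fin j → Fin k → Fin n)).filter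
          fun B => ∀ r, Function.Injective (B r),
        (j : ℝ) ^ (j - 1) * (((n : ℝ) ^ (1 + (k - 1) * j) * p n ^ (j * G.edgeFinset.card)) *
          ((n : ℝ) ^ (univ.image fun q : Fin j × Fin k => B q.1 q.2).card)⁻¹) := by
        refine mul_le_mul_of_nonneg_left ((abs_sum_le_sum_abs _ _).trans
          (sum_le_sum fun B hB => ?_)) (by positivity)
        exact abs_jointCumulant_edgeInd_le hk hj0 hnpos G hbal μ H hHm hH01 (hp n) h1 B
          (mem_filter.1 hB).2
    _ ≤ (autCard G : ℝ)⁻¹ ^ j * ((j : ℝ) ^ (j - 1) *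
        (((n : ℝ) ^ (1 + (k - 1) * j) * p n ^ (j * G.edgeFinset.card)) *
          ((j.factorial : ℝ) ^ k * (k.factorial : ℝ) ^ (j - 1)))) := by
        rw [← mul_sum, ← mul_sum]
        gcongr
        exact sum_inv_pow_card_image_le hnpos
    _ = _ := by
        rw [inv_pow, div_eq_mul_inv]
        ring
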